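/- Let M_n, ..., M_1 be finite-dimensional kG-modules. Then the map ψ_{M_n,...,M_1} : ⊕_p (M_n⊗⋯⊗M_1)^G_{p,irr} → (M_n⊗⋯⊗M_1)^G is bijective: every invariant of the tensor product decomposes uniquely as a sum of tensors of irreducible invariants of consecutive substrings. -/

import Mathlib

/-!
STATEMENT 3: For finite-dimensional `kG`-modules `M_n, …, M_1`, the map
`ψ : ⊕_p (M_n ⊗ ⋯ ⊗ M_1)^G_{p,irr} → (M_n ⊗ ⋯ ⊗ M_1)^G` is bijective: every
invariant of the tensor product decomposes uniquely as a sum of tensors of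
irreducible invariants of consecutive substrings.
-/

open scoped TensorProduct DirectSum Classical

section Strings

variable {k G : Type} [Field k] [Group G]
variable (M : ℕ → Type) [∀ i, AddCommGroup (M i)] [∀ i, Module k (M i)]

/-- The string `M_{i+m-1} ⊗ ⋯ ⊗ M_{i+1} ⊗ M_i` (tensor product of `m` consecutive
modules starting at `M_i`). -/
noncomputable def Str : ℕ → ℕ → ModuleCat k
  | _, 0 => ModuleCat.of k k
  | i, (m + 1) => ModuleCat.of k (↥(Str (i + 1) m) ⊗[k] M i)

/-- Transport along an equality of starting indices. -/
noncomputable def strCast {i j : ℕ} (h : i = j) (m : ℕ) :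
    ↥(Str (k := k) M i m) ≃ₗ[k] ↥(Str (k := k) M j m) :=
  h ▸ LinearEquiv.refl k ↥(Str (k := k) M i m)

/-- Transport along an equality of lengths. -/
noncomputable def strCastLen {i m m' : ℕ} (h : m = m') :
    ↥(Str (k := k) M i m) ≃ₗ[k] ↥(Str (k := k) M i m') :=
  h ▸ LinearEquiv.refl k ↥(Str (k := k) M i m)

/-- The canonical multiplication map
`(M_{i+b+a-1} ⊗ ⋯ ⊗ M_{i+b}) ⊗ (M_{i+b-1} ⊗ ⋯ ⊗ M_i) → M_{i+a+b-1} ⊗ ⋯ ⊗ M_i`. -/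
noncomputable def strMul : ∀ (a b i : ℕ),
    ↥(Str (k := k) M (i + b) a) →ₗ[k] ↥(Str (k := k) M i b) →ₗ[k] ↥(Str (k := k) M i (a + b))
  | a, 0, i => (LinearMap.lsmul k ↥(Str (k := k) M i a)).flip
  | a, b + 1, i =>
      (LinearMap.rTensorHom (M i)).comp
        ((strMul a b (i + 1)).comp
          (strCast (k := k) M (by omega : i + b + 1 = (i + 1) + b) a).toLinearMap)

variable (ρ : ∀ i, Representation k G (M i))

/-- The diagonal action of `g : G` on a string. -/
noncomputable def strAct : ∀ (i m : ℕ) (_ : G), ↥(Str (k := k) M i m) →ₗ[k] ↥(Str (k := k) M i m)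
  | _, 0, _ => LinearMap.id
  | i, m + 1, g => TensorProduct.map (strAct (i + 1) m g) (ρ i g)

/-- The invariants `(M_{i+m-1} ⊗ ⋯ ⊗ M_i)^G`. -/
noncomputable def strInv (i m : ℕ) : Submodule k ↥(Str (k := k) M i m) :=
  ⨅ g : G, LinearMap.eqLocus (strAct M ρ i m g) LinearMap.id

/-- The space of composite invariants: the span of products of invariants of the two
substrings of a proper two-fold partition. -/
noncomputable def strComp (i m : ℕ) : Submodule k ↥(Str (k := k) M i m) :=
  Submodule.span k {x | ∃ a b : ℕ, ∃ h : a + b = m, 0 < a ∧ 0 < b ∧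
    ∃ u ∈ strInv M ρ (i + b) a, ∃ w ∈ strInv M ρ i b,
      x = strCastLen M h (strMul M a b i u w)}

/-- Given a choice `Irr` of irreducible invariant subspaces, the tensor product of
the irreducible invariant spaces along a partition `l = [n_1, n_2, …]` (parts read
from the bottom). -/
noncomputable def TIrr (Irr : ∀ i m : ℕ, Submodule k ↥(Str (k := k) M i m)) :
    ℕ → List ℕ → ModuleCat k
  | _, [] => ModuleCat.of k k
  | i, (a :: l) => ModuleCat.of k (↥(TIrr Irr (i + a) l) ⊗[k] ↥(Irr i a))

/-- The multiplication map from the tensor product of irreducible invariant spaces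
along a partition into the full string. -/
noncomputable def iotaT (Irr : ∀ i m : ℕ, Submodule k ↥(Str (k := k) M i m)) :
    ∀ (i : ℕ) (l : List ℕ), ↥(TIrr (k := k) M Irr i l) →ₗ[k] ↥(Str (k := k) M i l.sum)
  | _, [] => LinearMap.id
  | i, (a :: l) =>
      TensorProduct.lift
        ((((strMul (k := k) M l.sum a i).comp (iotaT Irr (i + a) l)).compl₂
            (Irr i a).subtype).compr₂
          (strCastLen (k := k) M (by omega : l.sum + a = a + l.sum)).toLinearMap)

/-- Partitions of `n` into positive parts. -/
def Pt (n : ℕ) : Type := {l : List ℕ // l.sum = n ∧ ∀ a ∈ l, 0 < a}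

/-- The map `ψ = ⊕_p ψ_p` from the direct sum over all partitions of `n` of the
tensor products of irreducible invariant subspaces into the string of length `n`. -/
noncomputable def psiMap (Irr : ∀ i m : ℕ, Submodule k ↥(Str (k := k) M i m)) (n : ℕ) :
    (⨁ p : Pt n, ↥(TIrr (k := k) M Irr 0 p.1)) →ₗ[k] ↥(Str (k := k) M 0 n) :=
  DirectSum.toModule k _ _ fun p =>
    (strCastLen (k := k) M p.2.1).toLinearMap.comp (iotaT (k := k) M Irr 0 p.1)

end Strings

section Multiplication

variable {k G : Type} [Field k] [Group G]
variable {M : ℕ → Type} [∀ i, AddCommGroup (M i)] [∀ i, Module k (M i)]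

/-- Appending one more module at the bottom of a string. -/
noncomputable def strSnoc (i m : ℕ) :
    ↥(Str (k := k) M (i + 1) m) →ₗ[k] M i →ₗ[k] ↥(Str (k := k) M i (m + 1)) :=
  TensorProduct.mk k ↥(Str (k := k) M (i + 1) m) (M i)

theorem Str.induction_snoc {i m : ℕ} {P : ↥(Str (k := k) M i (m + 1)) → Prop}
    (x : ↥(Str (k := k) M i (m + 1))) (h0 : P 0)
    (hs : ∀ y z, P (strSnoc i m y z)) (ha : ∀ x y, P x → P y → P (x + y)) : P x :=
  TensorProduct.induction_on (motive := P) x h0 hs ha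

/-- `strMul` with the indices given up to propositional equality. -/
noncomputable def mulG {i j a b m : ℕ} (hj : i + b = j) (hm : a + b = m) :
    ↥(Str (k := k) M j a) →ₗ[k] ↥(Str (k := k) M i b) →ₗ[k] ↥(Str (k := k) M i m) := by
  subst hj
  subst hm
  exact strMul M a b i

theorem mulG_zero {i a : ℕ} (hj : i + 0 = i) (hm : a + 0 = a)
    (u : ↥(Str (k := k) M i a)) (s : k) :
    mulG (M := M) (b := 0) hj hm u s = s • u := rfl

theorem mulG_snoc {i j a b m : ℕ} (hj : i + (b + 1) = j) (hm : a + (b + 1) = m + 1)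
    (hj' : i + 1 + b = j) (hm' : a + b = m)
    (u : ↥(Str (k := k) M j a)) (w : ↥(Str (k := k) M (i + 1) b)) (x : M i) :
    mulG hj hm u (strSnoc i b w x) = strSnoc i m (mulG hj' hm' u w) x := by
  subst hj'
  subst hm'
  have key : ∀ (p q : ℕ) (h : p = q) (h₁ : i + 1 + b = p) (u : ↥(Str (k := k) M p a)),
      strSnoc i (a + b) (mulG (h₁.trans h) rfl (strCast M h a u) w) x
        = strSnoc i (a + b) (mulG h₁ rfl u w) x := by
    intro p q h h₁ u
    subst h
    rfl
  have gen : ∀ (p : ℕ) (h : i + (b + 1) = p) (h₁ : i + 1 + b = p)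
      (u : ↥(Str (k := k) M p a)),
      mulG h hm u (strSnoc i b w x) = strSnoc i (a + b) (mulG h₁ rfl u w) x := by
    intro p h h₁ u
    subst h
    exact key _ _ (by omega) h₁ u
  exact gen _ hj rfl u

theorem mulG_assoc : ∀ {i p q a b c ab bc m : ℕ} (h₁ : i + c = p) (h₂ : p + b = q)
    (h₃ : i + bc = q) (h₄ : b + c = bc) (h₅ : a + b = ab) (h₆ : a + bc = m) (h₇ : ab + c = m)
    (u : ↥(Str (k := k) M q a)) (v : ↥(Str (k := k) M p b)) (w : ↥(Str (k := k) M i c)),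
    mulG h₁ h₇ (mulG h₂ h₅ u v) w = mulG h₃ h₆ u (mulG h₁ h₄ v w) := by
  intro i p q a b c
  induction c generalizing i p q with
  | zero =>
    intro ab bc m h₁ h₂ h₃ h₄ h₅ h₆ h₇ u v w
    obtain rfl : i = p := h₁
    obtain rfl : b = bc := h₄
    obtain rfl : ab = m := h₇
    change k at w
    rw [mulG_zero, mulG_zero, map_smul]
  | succ c ih =>
    intro ab bc m h₁ h₂ h₃ h₄ h₅ h₆ h₇ u v w
    obtain rfl : (b + c) + 1 = bc := by omega
    obtain rfl : (ab + c) + 1 = m := by omega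
    induction w using Str.induction_snoc with
    | h0 => simp
    | hs y z =>
      rw [mulG_snoc h₁ h₇ (by omega) rfl, mulG_snoc h₁ h₄ (by omega) rfl,
        mulG_snoc h₃ h₆ (by omega) (by omega), ih]
    | ha x y hx hy => rw [map_add, map_add, map_add, hx, hy]

/-- The identification of scalars with the empty string. -/
noncomputable def strScalar (i : ℕ) : k →ₗ[k] ↥(Str (k := k) M i 0) := LinearMap.id

theorem strScalar_mulG {i j b : ℕ} (hj : i + b = j) (hm : 0 + b = b) (s : k)
    (w : ↥(Str (k := k) M i b)) :
    mulG hj hm (strScalar j s) w = s • w := by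
  induction b generalizing i j with
  | zero =>
    obtain rfl : i = j := hj
    exact mul_comm (show k from w) s
  | succ b ih =>
    induction w using Str.induction_snoc with
    | h0 => simp
    | hs y z =>
      rw [mulG_snoc hj hm (by omega) (by omega), ih, map_smul, LinearMap.smul_apply]
    | ha x y hx hy => rw [map_add, hx, hy, smul_add]

theorem strCastLen_strMul {i a b m : ℕ} (h : a + b = m)
    (u : ↥(Str (k := k) M (i + b) a)) (w : ↥(Str (k := k) M i b)) :
    strCastLen M h (strMul M a b i u w) = mulG rfl h u w := by
  subst h
  rfl

variable (ρ : ∀ i, Representation k G (M i))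

theorem strAct_snoc {i m : ℕ} (g : G) (w : ↥(Str (k := k) M (i + 1) m)) (x : M i) :
    strAct M ρ i (m + 1) g (strSnoc i m w x) =
      strSnoc i m (strAct M ρ (i + 1) m g w) (ρ i g x) := rfl

theorem strAct_mulG {i j a b m : ℕ} (hj : i + b = j) (hm : a + b = m) (g : G)
    (u : ↥(Str (k := k) M j a)) (w : ↥(Str (k := k) M i b)) :
    strAct M ρ i m g (mulG hj hm u w) =
      mulG hj hm (strAct M ρ j a g u) (strAct M ρ i b g w) := by
  induction b generalizing i j m with
  | zero =>
    obtain rfl : i = j := hj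
    obtain rfl : a = m := hm
    change k at w
    rw [mulG_zero, map_smul]
    exact (mulG_zero _ _ _ _).symm
  | succ b ih =>
    obtain rfl : (a + b) + 1 = m := by omega
    induction w using Str.induction_snoc with
    | h0 => simp
    | hs y z =>
      rw [mulG_snoc hj hm (by omega) rfl, strAct_snoc, strAct_snoc, ih,
        mulG_snoc hj hm (by omega) rfl]
    | ha x y hx hy => rw [map_add, map_add, map_add, map_add, hx, hy]

theorem mem_strInv {i m : ℕ} {x : ↥(Str (k := k) M i m)} :
    x ∈ strInv M ρ i m ↔ ∀ g, strAct M ρ i m g x = x := by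
  simp [strInv, Submodule.mem_iInf]

theorem mulG_mem_strInv {i j a b m : ℕ} (hj : i + b = j) (hm : a + b = m)
    {u : ↥(Str (k := k) M j a)} {w : ↥(Str (k := k) M i b)}
    (hu : u ∈ strInv M ρ j a) (hw : w ∈ strInv M ρ i b) :
    mulG hj hm u w ∈ strInv M ρ i m := by
  rw [mem_strInv] at *
  intro g
  rw [strAct_mulG, hu, hw]

theorem strInv_zero (i : ℕ) : strInv M ρ i 0 = ⊤ :=
  eq_top_iff.2 fun _ _ => (mem_strInv ρ).2 fun _ => rfl

theorem mulG_mem_strComp {i j a b m : ℕ} (hj : i + b = j) (hm : a + b = m)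
    (ha : 0 < a) (hb : 0 < b) {u : ↥(Str (k := k) M j a)} {w : ↥(Str (k := k) M i b)}
    (hu : u ∈ strInv M ρ j a) (hw : w ∈ strInv M ρ i b) :
    mulG hj hm u w ∈ strComp M ρ i m := by
  subst hj
  exact Submodule.subset_span ⟨a, b, hm, ha, hb, u, hu, w, hw, (strCastLen_strMul hm u w).symm⟩

/-- Contraction of the top `a` factors of a string against a linear functional. -/
noncomputable def strSlice {j a : ℕ} (φ : ↥(Str (k := k) M j a) →ₗ[k] k) :
    ∀ {b i m : ℕ} (_ : i + b = j) (_ : a + b = m),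
      ↥(Str (k := k) M i m) →ₗ[k] ↥(Str (k := k) M i b)
  | 0, i, m, hj, hm => by
      obtain rfl : i = j := hj
      obtain rfl : a = m := hm
      exact φ
  | b + 1, i, m, hj, hm => by
      obtain rfl : (a + b) + 1 = m := hm
      exact LinearMap.rTensor (M i)
        (strSlice φ (b := b) (i := i + 1) (m := a + b) (by omega) rfl)

theorem strSlice_snoc {j a b i m : ℕ} (φ : ↥(Str (k := k) M j a) →ₗ[k] k)
    (hj : i + (b + 1) = j) (hm : a + (b + 1) = m + 1) (hj' : i + 1 + b = j) (hm' : a + b = m)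
    (y : ↥(Str (k := k) M (i + 1) m)) (z : M i) :
    strSlice φ hj hm (strSnoc i m y z) = strSnoc i b (strSlice φ hj' hm' y) z := by
  subst hm'
  rfl

theorem strSlice_mulG {i p j a b c ab bc m : ℕ} (φ : ↥(Str (k := k) M j a) →ₗ[k] k)
    (h₁ : i + c = p) (h₂ : p + b = j) (h₃ : i + bc = j) (h₄ : b + c = bc) (h₅ : a + b = ab)
    (h₆ : a + bc = m) (h₇ : ab + c = m)
    (x : ↥(Str (k := k) M p ab)) (w : ↥(Str (k := k) M i c)) :
    strSlice φ h₃ h₆ (mulG h₁ h₇ x w) = mulG h₁ h₄ (strSlice φ h₂ h₅ x) w := by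
  induction c generalizing i p bc m with
  | zero =>
    obtain rfl : i = p := h₁
    obtain rfl : b = bc := h₄
    obtain rfl : ab = m := h₇
    change k at w
    rw [mulG_zero, mulG_zero, map_smul]
  | succ c ih =>
    obtain rfl : (b + c) + 1 = bc := by omega
    obtain rfl : (ab + c) + 1 = m := by omega
    induction w using Str.induction_snoc with
    | h0 => simp
    | hs y z =>
      rw [mulG_snoc h₁ h₇ (by omega) rfl, mulG_snoc h₁ h₄ (by omega) rfl,
        strSlice_snoc φ h₃ h₆ (by omega) (by omega), ih]
    | ha x y hx hy => rw [map_add, map_add, map_add, hx, hy]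

end Multiplication

section TensorBasis

variable {k : Type*} [Field k] {V V' W : Type*} [AddCommGroup V] [Module k V]
  [AddCommGroup V'] [Module k V'] [AddCommGroup W] [Module k W]

/-- Contraction of the right tensor factor against a linear functional. -/
noncomputable def TensorProduct.contractR (φ : W →ₗ[k] k) : V ⊗[k] W →ₗ[k] V :=
  (TensorProduct.rid k V).toLinearMap.comp (φ.lTensor V)

theorem TensorProduct.contractR_rTensor (φ : W →ₗ[k] k) (f : V →ₗ[k] V') (Y : V ⊗[k] W) :
    contractR φ (f.rTensor W Y) = f (contractR φ Y) := by
  induction Y with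
  | zero => simp
  | tmul v w => simp [contractR]
  | add x y hx hy => simp only [map_add, hx, hy]

theorem TensorProduct.eq_zero_of_forall_contractR {X : V ⊗[k] W}
    (h : ∀ φ : W →ₗ[k] k, contractR φ X = 0) : X = 0 := by
  obtain ⟨κ, ⟨B⟩⟩ : ∃ κ : Type _, Nonempty (Module.Basis κ k W) :=
    ⟨_, ⟨Module.Basis.ofVectorSpace k W⟩⟩
  apply (TensorProduct.equivFinsuppOfBasisRight B).injective
  ext t
  rw [TensorProduct.equivFinsuppOfBasisRight_apply]
  simpa [contractR] using h (B.coord t)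

theorem TensorProduct.eq_zero_of_forall_rTensor {X : V ⊗[k] W}
    (h : ∀ φ : V →ₗ[k] k, φ.rTensor W X = 0) : X = 0 := by
  obtain ⟨κ, ⟨B⟩⟩ : ∃ κ : Type _, Nonempty (Module.Basis κ k V) :=
    ⟨_, ⟨Module.Basis.ofVectorSpace k V⟩⟩
  apply (TensorProduct.equivFinsuppOfBasisLeft B).injective
  ext t
  rw [TensorProduct.equivFinsuppOfBasisLeft_apply, h]
  simp

theorem TensorProduct.mem_span_of_rTensor_fixed {ι : Type*} (f : ι → V →ₗ[k] V) {X : V ⊗[k] W}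
    (h : ∀ g, (f g).rTensor W X = X) :
    X ∈ Submodule.span k {x | ∃ v w, (∀ g, f g v = v) ∧ v ⊗ₜ[k] w = x} := by
  obtain ⟨κ, ⟨B⟩⟩ : ∃ κ : Type _, Nonempty (Module.Basis κ k W) :=
    ⟨_, ⟨Module.Basis.ofVectorSpace k W⟩⟩
  rw [← (TensorProduct.equivFinsuppOfBasisRight B).symm_apply_apply X,
    TensorProduct.equivFinsuppOfBasisRight_symm_apply, Finsupp.sum]
  refine Submodule.sum_mem _ fun t _ => Submodule.subset_span ⟨_, _, fun g => ?_, rfl⟩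
  rw [TensorProduct.equivFinsuppOfBasisRight_apply]
  exact (contractR_rTensor (B.coord t) (f g) X).symm.trans (by rw [h]; rfl)

end TensorBasis

section Independence

variable {k G : Type} [Field k] [Group G]
variable {M : ℕ → Type} [∀ i, AddCommGroup (M i)] [∀ i, Module k (M i)]
variable (Irr : ∀ i m : ℕ, Submodule k ↥(Str (k := k) M i m))

/-- Multiplication of arbitrary tensors by elements of `Irr i a`, landing in length `m`;
it is zero unless `a ≤ m`. -/
noncomputable def irrMul (i m a : ℕ) :
    ↥(Str (k := k) M (i + a) (m - a)) ⊗[k] ↥(Irr i a) →ₗ[k] ↥(Str (k := k) M i m) :=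
  if h : a ≤ m then
    TensorProduct.lift ((mulG rfl (Nat.sub_add_cancel h)).compl₂ (Irr i a).subtype)
  else 0

theorem irrMul_tmul {i m a : ℕ} (h : a ≤ m) (u : ↥(Str (k := k) M (i + a) (m - a)))
    (w : ↥(Irr i a)) :
    irrMul Irr i m a (u ⊗ₜ w) = mulG rfl (Nat.sub_add_cancel h) u (w : ↥(Str (k := k) M i a)) := by
  simp [irrMul, h]

theorem irrMul_of_lt {i m a : ℕ} (h : m < a) : irrMul Irr i m a = 0 := by
  simp [irrMul, h.not_ge]

theorem strSlice_irrMul {i m A a : ℕ} (haA : a ≤ A) (hA : A ≤ m)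
    (φ : ↥(Str (k := k) M (i + A) (m - A)) →ₗ[k] k)
    (X : ↥(Str (k := k) M (i + a) (m - a)) ⊗[k] ↥(Irr i a)) :
    strSlice φ rfl (Nat.sub_add_cancel hA) (irrMul Irr i m a X) =
      irrMul Irr i A a ((strSlice φ (by omega : i + a + (A - a) = i + A)
        (by omega : m - A + (A - a) = m - a)).rTensor _ X) := by
  induction X with
  | zero => simp
  | tmul u w =>
    rw [LinearMap.rTensor_tmul, irrMul_tmul _ haA, irrMul_tmul _ (haA.trans hA)]
    exact strSlice_mulG ..
  | add x y hx hy => rw [map_add, map_add, map_add, map_add, hx, hy]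

theorem mulG_strSlice_zero {i j a b c : ℕ} (hb : b = 0) (φ : ↥(Str (k := k) M j a) →ₗ[k] k)
    (h₁ : j + b = j) (h₂ : a + b = a) (h₃ : i + c = j) (h₄ : b + c = c)
    (x : ↥(Str (k := k) M j a)) (w : ↥(Str (k := k) M i c)) :
    mulG h₃ h₄ (strSlice φ h₁ h₂ x) w = φ x • w := by
  subst hb
  exact strScalar_mulG h₃ h₄ (φ x) w

theorem irrMul_strSlice_self {i m A : ℕ} (h₁ : i + A + (A - A) = i + A)
    (h₂ : m - A + (A - A) = m - A) (φ : ↥(Str (k := k) M (i + A) (m - A)) →ₗ[k] k)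
    (X : ↥(Str (k := k) M (i + A) (m - A)) ⊗[k] ↥(Irr i A)) :
    irrMul Irr i A A ((strSlice φ h₁ h₂).rTensor _ X) =
      (TensorProduct.lid k ↥(Irr i A) (φ.rTensor _ X) : ↥(Irr i A)) := by
  induction X with
  | zero => simp
  | tmul u w =>
    rw [LinearMap.rTensor_tmul, irrMul_tmul _ le_rfl, LinearMap.rTensor_tmul,
      TensorProduct.lid_tmul, mulG_strSlice_zero (Nat.sub_self A)]
    rfl
  | add x y hx hy => rw [map_add, map_add, map_add, map_add, hx, hy]; rfl

variable (ρ : ∀ i, Representation k G (M i))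

theorem strAct_irrMul {i m a : ℕ} (hI : Irr i a ≤ strInv M ρ i a) (g : G)
    (X : ↥(Str (k := k) M (i + a) (m - a)) ⊗[k] ↥(Irr i a)) :
    strAct M ρ i m g (irrMul Irr i m a X) =
      irrMul Irr i m a ((strAct M ρ (i + a) (m - a) g).rTensor _ X) := by
  by_cases h : a ≤ m
  · induction X with
    | zero => simp
    | tmul u w =>
      rw [LinearMap.rTensor_tmul, irrMul_tmul _ h, irrMul_tmul _ h, strAct_mulG,
        (mem_strInv ρ).1 (hI w.2) g]
    | add x y hx hy => rw [map_add, map_add, map_add, map_add, hx, hy]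
  · simp [irrMul_of_lt Irr (not_le.1 h)]

theorem irrMul_mem_strComp {i m a : ℕ} (ha : 0 < a) (ham : a < m)
    (hI : Irr i a ≤ strInv M ρ i a)
    (X : ↥(Str (k := k) M (i + a) (m - a)) ⊗[k] ↥(Irr i a))
    (hX : ∀ g, (strAct M ρ (i + a) (m - a) g).rTensor _ X = X) :
    irrMul Irr i m a X ∈ strComp M ρ i m := by
  refine Submodule.span_le (p := (strComp M ρ i m).comap (irrMul Irr i m a)).2 ?_
    (TensorProduct.mem_span_of_rTensor_fixed _ hX)
  rintro _ ⟨v, w, hv, rfl⟩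
  rw [SetLike.mem_coe, Submodule.mem_comap, irrMul_tmul _ ham.le]
  exact mulG_mem_strComp ρ _ _ (by omega) ha ((mem_strInv ρ).2 hv) (hI w.2)

/-- A complement of the composite invariants is independent over arbitrary tensors. -/
theorem irrMul_independent
    (hIrr : ∀ i m : ℕ, 0 < m →
      strComp M ρ i m ⊓ Irr i m = ⊥ ∧ strComp M ρ i m ⊔ Irr i m = strInv M ρ i m)
    (i A m : ℕ) (hA : A ≤ m)
    (X : ∀ a, ↥(Str (k := k) M (i + a) (m - a)) ⊗[k] ↥(Irr i a))
    (hX : ∑ a ∈ Finset.Icc 1 A, irrMul Irr i m a (X a) = 0) :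
    ∀ a ∈ Finset.Icc 1 A, X a = 0 := by
  induction A generalizing m with
  | zero => simp
  | succ A ih =>
    have hI : ∀ a, 0 < a → Irr i a ≤ strInv M ρ i a := fun a ha =>
      le_sup_right.trans (hIrr i a ha).2.le
    have top : X (A + 1) = 0 := by
      refine TensorProduct.eq_zero_of_forall_rTensor fun φ => ?_
      let Y : ∀ a, ↥(Str (k := k) M (i + a) (A + 1 - a)) ⊗[k] ↥(Irr i a) := fun a =>
        if h : a ≤ A + 1 then
          (strSlice φ (by omega : i + a + (A + 1 - a) = i + (A + 1))
            (by omega : m - (A + 1) + (A + 1 - a) = m - a)).rTensor _ (X a)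
        else 0
      set w := TensorProduct.lid k ↥(Irr i (A + 1)) (φ.rTensor _ (X (A + 1))) with hw
      have slice : ∀ a ∈ Finset.Icc 1 (A + 1),
          strSlice φ rfl (Nat.sub_add_cancel hA) (irrMul Irr i m a (X a)) =
            irrMul Irr i (A + 1) a (Y a) := by
        intro a ha
        have haA := (Finset.mem_Icc.1 ha).2
        simp only [Y, dif_pos haA]
        exact strSlice_irrMul Irr haA hA φ (X a)
      have last : irrMul Irr i (A + 1) (A + 1) (Y (A + 1)) = w := by
        simp only [Y, dif_pos le_rfl]
        exact irrMul_strSlice_self Irr _ _ φ (X (A + 1))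
      have relation : ∑ a ∈ Finset.Icc 1 A, irrMul Irr i (A + 1) a (Y a) = -w := by
        rw [← add_eq_zero_iff_eq_neg, ← last, ← Finset.sum_Icc_succ_top (by omega),
          ← Finset.sum_congr rfl slice, ← map_sum, hX, map_zero]
      have fixed : ∀ g, ∀ a ∈ Finset.Icc 1 A,
          (strAct M ρ (i + a) (A + 1 - a) g).rTensor _ (Y a) = Y a := by
        intro g a ha
        rw [← sub_eq_zero]
        refine ih (A + 1) (by omega)
          (fun a => (strAct M ρ (i + a) (A + 1 - a) g).rTensor _ (Y a) - Y a) ?_ a ha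
        simp only [map_sub, Finset.sum_sub_distrib]
        have act : ∀ a ∈ Finset.Icc 1 A, strAct M ρ i (A + 1) g (irrMul Irr i (A + 1) a (Y a)) =
            irrMul Irr i (A + 1) a ((strAct M ρ (i + a) (A + 1 - a) g).rTensor _ (Y a)) :=
          fun a ha => strAct_irrMul Irr ρ (hI a (Finset.mem_Icc.1 ha).1) g (Y a)
        rw [← Finset.sum_congr rfl act, ← map_sum, relation,
          map_neg, (mem_strInv ρ).1 (hI (A + 1) (by omega) w.2) g, sub_self]
      have composite : (w : ↥(Str (k := k) M i (A + 1))) ∈ strComp M ρ i (A + 1) := by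
        rw [← neg_neg (w : ↥(Str (k := k) M i (A + 1))), ← relation]
        refine Submodule.neg_mem _ (Submodule.sum_mem _ fun a ha => ?_)
        have := Finset.mem_Icc.1 ha
        exact irrMul_mem_strComp Irr ρ (by omega) (by omega) (hI a (by omega)) _
          fun g => fixed g a ha
      have hw0 : w = 0 := by
        have := (hIrr i (A + 1) (by omega)).1.le ⟨composite, w.2⟩
        simpa using this
      exact (LinearEquiv.map_eq_zero_iff _).1 (hw.symm.trans hw0)
    rw [Finset.sum_Icc_succ_top (by omega), top, map_zero, add_zero] at hX
    intro a ha
    rcases eq_or_ne a (A + 1) with rfl | hne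
    · exact top
    · exact ih m (by omega) X hX a (by grind)

end Independence

section Partitions

variable {k G : Type} [Field k] [Group G]
variable {M : ℕ → Type} [∀ i, AddCommGroup (M i)] [∀ i, Module k (M i)]
variable (Irr : ∀ i m : ℕ, Submodule k ↥(Str (k := k) M i m))

/-- The defining decomposition of `TIrr` along the bottom part. -/
noncomputable def tIrrCons (i a : ℕ) (l : List ℕ) :
    ↥(TIrr M Irr i (a :: l)) ≃ₗ[k] ↥(TIrr M Irr (i + a) l) ⊗[k] ↥(Irr i a) :=
  LinearEquiv.refl k _

/-- `iotaT` landing in length `n`; it is zero unless the parts sum to `n`. -/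
noncomputable def iotaG (i n : ℕ) (l : List ℕ) :
    ↥(TIrr M Irr i l) →ₗ[k] ↥(Str (k := k) M i n) :=
  if h : l.sum = n then (strCastLen M h).toLinearMap.comp (iotaT M Irr i l) else 0

theorem iotaG_nil (i : ℕ) (x : ↥(TIrr M Irr i [])) : iotaG Irr i 0 [] x = x := by
  simp only [iotaG, List.sum_nil]
  rfl

theorem strCastLen_strCastLen_strMul {i a b m m' : ℕ} (h : a + b = m) (h' : m = m')
    (h'' : a + b = m')
    (u : ↥(Str (k := k) M (i + b) a)) (w : ↥(Str (k := k) M i b)) :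
    strCastLen M h' (strCastLen M h (strMul M a b i u w)) = mulG rfl h'' u w := by
  subst h'
  exact strCastLen_strMul h u w

theorem mulG_strCastLen {i j a a' b m : ℕ} (h : a = a') (hj : i + b = j) (hm : a + b = m)
    (hm' : a' + b = m)
    (u : ↥(Str (k := k) M j a)) (w : ↥(Str (k := k) M i b)) :
    mulG hj hm' (strCastLen M h u) w = mulG hj hm u w := by
  subst h
  rfl

theorem iotaG_cons {i n a : ℕ} (h : a ≤ n) (l : List ℕ) (x : ↥(TIrr M Irr i (a :: l))) :
    iotaG Irr i n (a :: l) x =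
      irrMul Irr i n a ((iotaG Irr (i + a) (n - a) l).rTensor _ (tIrrCons Irr i a l x)) := by
  by_cases hl : l.sum = n - a
  · have hl' : (a :: l).sum = n := by simp only [List.sum_cons]; omega
    obtain ⟨x, rfl⟩ := (tIrrCons Irr i a l).symm.surjective x
    rw [LinearEquiv.apply_symm_apply]
    induction x with
    | zero => simp
    | tmul t w =>
      rw [LinearMap.rTensor_tmul, irrMul_tmul _ h]
      simp only [iotaG, dif_pos hl, dif_pos hl', LinearMap.comp_apply, LinearEquiv.coe_coe]
      rw [mulG_strCastLen hl rfl (by omega)]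
      exact strCastLen_strCastLen_strMul _ hl' _ _ _
    | add x y hx hy => rw [map_add, map_add, map_add, map_add, hx, hy]
  · have hl' : (a :: l).sum ≠ n := by simp only [List.sum_cons]; omega
    simp only [iotaG, dif_neg hl, dif_neg hl', LinearMap.rTensor_zero, LinearMap.zero_apply,
      map_zero]

theorem sum_eq_sum_cons {β : Type*} [AddCommMonoid β] {n : ℕ} (hn : 0 < n) (S : Finset (List ℕ))
    (hS : ∀ l ∈ S, l.sum = n ∧ ∀ a ∈ l, 0 < a) (f : List ℕ → β) :
    ∑ l ∈ S, f l = ∑ a ∈ Finset.Icc 1 n,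
      ∑ l ∈ S.preimage (List.cons a) (List.cons_injective.injOn), f (a :: l) := by
  have maps : ∀ l ∈ S, l.headI ∈ Finset.Icc 1 n := by
    rintro (_ | ⟨a, l⟩) hl
    · exact absurd (hS _ hl).1 (by simpa using hn.ne)
    · have := hS _ hl
      simp only [List.sum_cons, List.mem_cons, forall_eq_or_imp] at this
      simp only [List.headI_cons, Finset.mem_Icc]
      omega
  rw [← Finset.sum_fiberwise_of_maps_to maps]
  refine Finset.sum_congr rfl fun a _ => (Finset.sum_bij (fun l _ => a :: l) ?_ ?_ ?_ ?_).symm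
  · intro l hl
    simpa using hl
  · intro l _ l' _ h
    exact List.cons_injective h
  · rintro (_ | ⟨b, l⟩) hl
    · rw [Finset.mem_filter] at hl
      exact absurd (hS _ hl.1).1 (by simpa using hn.ne)
    · obtain ⟨hbl, hba⟩ := Finset.mem_filter.1 hl
      obtain rfl : b = a := hba
      exact ⟨l, Finset.mem_preimage.2 hbl, rfl⟩
  · intros
    rfl

variable (ρ : ∀ i, Representation k G (M i))

theorem iotaG_independent
    (hIrr : ∀ i m : ℕ, 0 < m →
      strComp M ρ i m ⊓ Irr i m = ⊥ ∧ strComp M ρ i m ⊔ Irr i m = strInv M ρ i m)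
    (i n : ℕ) (S : Finset (List ℕ)) (hS : ∀ l ∈ S, l.sum = n ∧ ∀ a ∈ l, 0 < a)
    (X : ∀ l, ↥(TIrr M Irr i l)) (hX : ∑ l ∈ S, iotaG Irr i n l (X l) = 0) :
    ∀ l ∈ S, X l = 0 := by
  induction n using Nat.strong_induction_on generalizing i S with
  | _ n ih =>
  rcases Nat.eq_zero_or_pos n with rfl | hn
  · have nil : ∀ l ∈ S, l = [] := by
      rintro (_ | ⟨a, l⟩) hl
      · rfl
      · have := hS _ hl
        simp only [List.sum_cons, List.mem_cons, forall_eq_or_imp] at this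
        omega
    intro l hl
    obtain rfl := nil l hl
    rw [Finset.sum_eq_single_of_mem [] hl fun l' hl' h => absurd (nil l' hl') h,
      iotaG_nil] at hX
    exact hX
  · rw [sum_eq_sum_cons hn S hS] at hX
    let Z : ∀ a, ↥(Str (k := k) M (i + a) (n - a)) ⊗[k] ↥(Irr i a) := fun a =>
      ∑ l ∈ S.preimage (List.cons a) (List.cons_injective.injOn),
        (iotaG Irr (i + a) (n - a) l).rTensor _ (tIrrCons Irr i a l (X (a :: l)))
    have hZ : ∑ a ∈ Finset.Icc 1 n, irrMul Irr i n a (Z a) = 0 := by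
      rw [← hX]
      refine Finset.sum_congr rfl fun a ha => ?_
      rw [map_sum]
      exact Finset.sum_congr rfl fun l _ =>
        (iotaG_cons Irr (Finset.mem_Icc.1 ha).2 l (X (a :: l))).symm
    have hZ0 := irrMul_independent Irr ρ hIrr i n n le_rfl Z hZ
    rintro (_ | ⟨a, l⟩) hl
    · exact absurd (hS _ hl).1 (by simpa using hn.ne)
    · have hal := hS _ hl
      simp only [List.sum_cons, List.mem_cons, forall_eq_or_imp] at hal
      apply (tIrrCons Irr i a l).injective
      rw [map_zero]
      refine TensorProduct.eq_zero_of_forall_contractR fun φ => ?_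
      refine ih (n - a) (by omega) (i + a)
        (S.preimage (List.cons a) (List.cons_injective.injOn)) ?_
        (fun l => TensorProduct.contractR φ (tIrrCons Irr i a l (X (a :: l))))
        ?_ l (by simpa using hl)
      · intro l' hl'
        have := hS _ (Finset.mem_preimage.1 hl')
        simp only [List.sum_cons, List.mem_cons, forall_eq_or_imp] at this
        exact ⟨by omega, this.2.2⟩
      · have hZa := congrArg (TensorProduct.contractR φ)
          (hZ0 a (Finset.mem_Icc.2 ⟨hal.2.1, by omega⟩))
        rw [map_sum, map_zero] at hZa
        rw [← hZa]
        exact Finset.sum_congr rfl fun l _ =>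
          (TensorProduct.contractR_rTensor φ (iotaG Irr (i + a) (n - a) l) _).symm

theorem iotaG_mem_strInv (hI : ∀ i a, 0 < a → Irr i a ≤ strInv M ρ i a) (i n : ℕ) (l : List ℕ)
    (hl : l.sum = n ∧ ∀ a ∈ l, 0 < a) (x : ↥(TIrr M Irr i l)) :
    iotaG Irr i n l x ∈ strInv M ρ i n := by
  induction l generalizing i n with
  | nil =>
    obtain rfl : 0 = n := hl.1
    rw [strInv_zero]
    trivial
  | cons a l ih =>
    simp only [List.sum_cons, List.mem_cons, forall_eq_or_imp] at hl
    have han : a ≤ n := by omega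
    rw [iotaG_cons Irr han]
    generalize tIrrCons Irr i a l x = y
    induction y with
    | zero =>
      rw [map_zero, map_zero]
      exact Submodule.zero_mem _
    | tmul t w =>
      rw [LinearMap.rTensor_tmul, irrMul_tmul _ han]
      exact mulG_mem_strInv ρ _ _ (ih _ _ ⟨by omega, hl.2.2⟩ t) (hI i a hl.2.1 w.2)
    | add x y hx hy =>
      rw [map_add, map_add]
      exact Submodule.add_mem _ hx hy

theorem strInv_le_iSup_range_iotaG
    (hIrr : ∀ i m : ℕ, 0 < m →
      strComp M ρ i m ⊓ Irr i m = ⊥ ∧ strComp M ρ i m ⊔ Irr i m = strInv M ρ i m)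
    (i n : ℕ) :
    strInv M ρ i n ≤ ⨆ p : Pt n, LinearMap.range (iotaG Irr i n p.1) := by
  induction n using Nat.strong_induction_on generalizing i with
  | _ n ih =>
  rcases Nat.eq_zero_or_pos n with rfl | hn
  · intro x _
    refine Submodule.mem_iSup_of_mem (⟨[], rfl, by simp⟩ : Pt 0) ⟨x, ?_⟩
    exact iotaG_nil Irr i x
  · have products : ∀ (b : ℕ), 0 < b → ∀ (a j : ℕ) (hj : i + b = j) (hm : a + b = n),
        ∀ u ∈ strInv M ρ j a, ∀ w ∈ strInv M ρ i b,
          mulG hj hm u w ∈ ⨆ p : Pt n, LinearMap.range (iotaG Irr i n p.1) := by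
      intro b
      induction b using Nat.strong_induction_on with
      | _ b ihb =>
      intro hb a j hj hm u hu w hw
      rw [← (hIrr i b hb).2] at hw
      obtain ⟨c, hc, d, hd, rfl⟩ := Submodule.mem_sup.1 hw
      rw [map_add]
      refine Submodule.add_mem _ ?_ ?_
      · refine Submodule.span_le (p := (⨆ p : Pt n,
          LinearMap.range (iotaG Irr i n p.1)).comap (mulG hj hm u)).2 ?_ hc
        rintro _ ⟨a', b', h, ha', hb', u', hu', w', hw', rfl⟩
        rw [SetLike.mem_coe, Submodule.mem_comap, strCastLen_strMul,
          ← mulG_assoc rfl (by omega) hj h rfl hm (by omega)]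
        exact ihb b' (by omega) hb' _ _ _ _ _ (mulG_mem_strInv ρ _ _ hu hu') w' hw'
      · obtain rfl : a = n - b := by omega
        subst hj
        have hbn : b ≤ n := by omega
        refine iSup_le (a := (⨆ p : Pt n, LinearMap.range (iotaG Irr i n p.1)).comap
          ((mulG rfl hm).flip d)) ?_ (ih (n - b) (by omega) (i + b) hu)
        rintro ⟨l, hl⟩ _ ⟨t, rfl⟩
        have hbl : (b :: l).sum = n ∧ ∀ a ∈ b :: l, 0 < a := by
          simp only [List.sum_cons, List.mem_cons, forall_eq_or_imp]
          exact ⟨by omega, hb, hl.2⟩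
        refine Submodule.mem_iSup_of_mem (⟨b :: l, hbl⟩ : Pt n)
          ⟨(tIrrCons Irr i b l).symm (t ⊗ₜ ⟨d, hd⟩), ?_⟩
        rw [iotaG_cons Irr hbn, LinearEquiv.apply_symm_apply, LinearMap.rTensor_tmul,
          irrMul_tmul _ hbn, LinearMap.flip_apply]
    intro x hx
    have := products n hn 0 _ rfl (zero_add n) (strScalar _ 1)
      (by rw [strInv_zero]; trivial) x hx
    rwa [strScalar_mulG, one_smul] at this

end Partitions

section DirectSum

variable {k ι V : Type*} [Semiring k] [DecidableEq ι] {β : ι → Type*}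
  [∀ p, AddCommMonoid (β p)] [∀ p, Module k (β p)] [AddCommMonoid V] [Module k V]

theorem DirectSum.exists_toModule_eq_sum (f : ∀ p, β p →ₗ[k] V) (X : ⨁ p, β p) :
    ∃ S : Finset ι, (∀ p ∉ S, X p = 0) ∧
      DirectSum.toModule k ι V f X = ∑ p ∈ S, f p (X p) := by
  refine ⟨DFinsupp.support X, fun p hp => DFinsupp.notMem_support_iff.1 hp, ?_⟩
  rw [DirectSum.toModule, DFinsupp.lsum_apply_apply, DFinsupp.sumAddHom_apply]
  rfl

theorem DirectSum.range_toModule_eq_iSup (f : ∀ p, β p →ₗ[k] V) :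
    LinearMap.range (DirectSum.toModule k ι V f) = ⨆ p, LinearMap.range (f p) := by
  refine le_antisymm ?_ (iSup_le fun p => ?_)
  · rintro _ ⟨X, rfl⟩
    obtain ⟨S, -, hS⟩ := exists_toModule_eq_sum f X
    rw [hS]
    exact Submodule.sum_mem _ fun p _ => Submodule.mem_iSup_of_mem p ⟨X p, rfl⟩
  · rintro _ ⟨x, rfl⟩
    exact ⟨DirectSum.lof k ι β p x, DirectSum.toModule_lof k p x⟩

end DirectSum

theorem psiMap_eq_toModule_iotaG
    {k : Type} [Field k] (M : ℕ → Type) [∀ i, AddCommGroup (M i)] [∀ i, Module k (M i)]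
    (Irr : ∀ i m : ℕ, Submodule k ↥(Str (k := k) M i m)) (n : ℕ) :
    psiMap M Irr n = DirectSum.toModule k (Pt n) _ fun p => iotaG Irr 0 n p.1 := by
  unfold psiMap
  congr 1
  funext p
  rw [iotaG, dif_pos p.2.1]

/-- Bijectivity of `ψ` for finite-dimensional modules. -/
theorem psi_bijective_general
    {k G : Type} [Field k] [Group G] [Finite G]
    (M : ℕ → Type) [∀ i, AddCommGroup (M i)] [∀ i, Module k (M i)]
    [∀ i, FiniteDimensional k (M i)]
    (ρ : ∀ i, Representation k G (M i))
    (Irr : ∀ i m : ℕ, Submodule k ↥(Str (k := k) M i m))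
    (hIrr : ∀ i m : ℕ, 0 < m →
      strComp M ρ i m ⊓ Irr i m = ⊥ ∧ strComp M ρ i m ⊔ Irr i m = strInv M ρ i m)
    (n : ℕ) :
    Function.Injective (psiMap (k := k) M Irr n) ∧
    LinearMap.range (psiMap (k := k) M Irr n) = strInv M ρ 0 n := by
  have hI : ∀ i a, 0 < a → Irr i a ≤ strInv M ρ i a := fun i a ha =>
    le_sup_right.trans (hIrr i a ha).2.le
  rw [psiMap_eq_toModule_iotaG]
  refine ⟨(injective_iff_map_eq_zero _).2 fun X hX => ?_, ?_⟩
  · let X' : ∀ l, ↥(TIrr M Irr 0 l) := fun l =>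
      if h : l.sum = n ∧ ∀ a ∈ l, 0 < a then X ⟨l, h⟩ else 0
    have hX' : ∀ p : Pt n, X' p.1 = X p := fun p => dif_pos p.2
    obtain ⟨S, hS, hsum⟩ := DirectSum.exists_toModule_eq_sum (fun p => iotaG Irr 0 n p.1) X
    let e : Pt n ↪ List ℕ := ⟨fun p => p.1, Subtype.val_injective⟩
    have sum_zero : ∑ l ∈ S.map e, iotaG Irr 0 n l (X' l) = 0 := by
      rw [← hX, hsum, Finset.sum_map]
      exact Finset.sum_congr rfl fun p _ => congrArg (iotaG Irr 0 n p.1) (hX' p)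
    have vanish := iotaG_independent Irr ρ hIrr 0 n _
      (fun l hl => by
        obtain ⟨p, _, rfl⟩ := Finset.mem_map.1 hl
        exact p.2) X' sum_zero
    refine DFinsupp.ext fun p => ?_
    by_cases hp : p ∈ S
    · exact (hX' p).symm.trans (vanish p.1 (Finset.mem_map_of_mem e hp))
    · exact hS p hp
  · rw [DirectSum.range_toModule_eq_iSup]
    refine le_antisymm (iSup_le fun p => ?_) (strInv_le_iSup_range_iotaG Irr ρ hIrr 0 n)
    rintro _ ⟨x, rfl⟩
    exact iotaG_mem_strInv Irr ρ hI 0 n p.1 p.2 x
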